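/- For every natural number N and all indices λ, μ, ν in Fin n, the following identity holds in the polynomial ring k[X_1,…,X_n]: ∑_{p+q=N+1} ((−1)^p/p!)·((−1)^q B_q/q!) · ∑_ρ δ_ρ((𝒞^p)^λ_μ) · (𝒞^q)^ρ_ν = −((−1)^N/N!) · ∑_ρ C^λ_{ρν} · (𝒞^N)^ρ_μ, where the outer sum is over pairs of natural numbers (p,q) with p+q = N+1. (This is the degree-N homogeneous component of the power-series identity (δ_ρ (𝒪^{−1})^λ_μ) φ^ρ_ν = −C^λ_{ρν} (𝒪^{−1})^ρ_μ, which expresses the commutator identity [(𝒪^{−1})^λ_μ, x̂_ν] = −C^λ_{ρν}(𝒪^{−1})^ρ_μ of Theorem 2.2, equation (11), in the realization x̂_ν = x_ρ φ^ρ_ν.) -/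

import Mathlib

open Finset MvPolynomial


/-- Homogeneous form of `(e^x - e^y) / (x - y) * (x - y) / (e^(x - y) - 1) = e^y`,
multiplied by `x - y`. -/
theorem sum_bernoulli_mul_pow_sub_pow {R : Type*} [CommRing R] [Algebra ℚ R] (x y : R) (N : ℕ) :
    ∑ pq ∈ antidiagonal (N + 1),
        algebraMap ℚ R (bernoulli pq.2 / (pq.1.factorial * pq.2.factorial)) *
          ((x ^ pq.1 - y ^ pq.1) * (x - y) ^ pq.2)
      = algebraMap ℚ R (1 / N.factorial) * y ^ N * (x - y) := by
  have hexp : PowerSeries.rescale x (PowerSeries.exp R)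
      = PowerSeries.rescale y (PowerSeries.exp R)
        * PowerSeries.rescale (x - y) (PowerSeries.exp R) := by
    rw [PowerSeries.exp_mul_exp_eq_exp_add, add_sub_cancel]
  have h : (PowerSeries.rescale x (PowerSeries.exp R) - PowerSeries.rescale y (PowerSeries.exp R))
      * PowerSeries.rescale (x - y) (bernoulliPowerSeries R)
      = PowerSeries.rescale y (PowerSeries.exp R) * PowerSeries.rescale (x - y) PowerSeries.X := by
    rw [← bernoulliPowerSeries_mul_exp_sub_one, map_mul, map_sub, map_one, hexp]
    ring
  have h' := congrArg (PowerSeries.coeff (N + 1)) h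
  rw [PowerSeries.rescale_X, mul_left_comm, PowerSeries.coeff_C_mul,
    PowerSeries.coeff_succ_mul_X, PowerSeries.coeff_mul] at h'
  simp only [map_sub, PowerSeries.coeff_rescale, PowerSeries.coeff_exp, bernoulliPowerSeries,
    PowerSeries.coeff_mk] at h'
  rw [mul_comm (algebraMap ℚ R _), mul_comm _ (x - y), ← h']
  refine sum_congr rfl fun pq _ => ?_
  have e : (bernoulli pq.2 / (pq.1.factorial * pq.2.factorial) : ℚ)
      = 1 / pq.1.factorial * (bernoulli pq.2 / pq.2.factorial) := by
    rw [div_mul_div_comm, one_mul]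
  rw [e, map_mul]
  ring

theorem sum_bernoulli_mul_geom_sum_of_isDomain {R : Type*} [CommRing R] [IsDomain R] [Algebra ℚ R]
    {x y : R} (hxy : x ≠ y) (N : ℕ) :
    ∑ pq ∈ antidiagonal (N + 1),
        algebraMap ℚ R (bernoulli pq.2 / (pq.1.factorial * pq.2.factorial)) *
          ((∑ i ∈ range pq.1, x ^ i * y ^ (pq.1 - 1 - i)) * (x - y) ^ pq.2)
      = algebraMap ℚ R (1 / N.factorial) * y ^ N := by
  refine mul_right_cancel₀ (sub_ne_zero.mpr hxy) ?_
  rw [← sum_bernoulli_mul_pow_sub_pow, sum_mul]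
  refine sum_congr rfl fun pq _ => ?_
  rw [← (Commute.all x y).geom_sum₂_mul]
  ring

/-- Homogeneous form of `(e^a - e^b) / (a - b) * (a - b) / (e^(a - b) - 1) = e^b`
for commuting elements of a `ℚ`-algebra. -/
theorem Commute.sum_bernoulli_mul_geom_sum {S : Type*} [Ring S] [Algebra ℚ S] {a b : S}
    (h : Commute a b) (N : ℕ) :
    ∑ pq ∈ antidiagonal (N + 1),
        algebraMap ℚ S (bernoulli pq.2 / (pq.1.factorial * pq.2.factorial)) *
          ((∑ i ∈ range pq.1, a ^ i * b ^ (pq.1 - 1 - i)) * (a - b) ^ pq.2)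
      = algebraMap ℚ S (1 / N.factorial) * b ^ N := by
  have hc : ∀ p : Polynomial ℚ, Commute ((Polynomial.aeval b : Polynomial ℚ →ₐ[ℚ] S) p) a := by
    intro p
    induction p using Polynomial.induction_on' with
    | add p q hp hq => rw [map_add]; exact hp.add_left hq
    | monomial m c =>
      rw [Polynomial.aeval_monomial]
      exact (Algebra.commute_algebraMap_left c a).mul_left (h.symm.pow_left m)
  let f : Polynomial (Polynomial ℚ) →+* S :=
    Polynomial.eval₂RingHom' (Polynomial.aeval b : Polynomial ℚ →ₐ[ℚ] S).toRingHom a hc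
  have fX : f Polynomial.X = a := Polynomial.eval₂_X _ _
  have fC : f (Polynomial.C Polynomial.X) = b :=
    (Polynomial.eval₂_C _ _).trans (Polynomial.aeval_X b)
  have fq : ∀ c : ℚ, f (algebraMap ℚ _ c) = algebraMap ℚ S c := fun c =>
    RingHom.congr_fun (RingHom.ext_rat (f.comp (algebraMap ℚ _)) (algebraMap ℚ S)) c
  have key := congrArg f (sum_bernoulli_mul_geom_sum_of_isDomain
    (Polynomial.X_ne_C (Polynomial.X : Polynomial ℚ)) N)
  simpa only [map_sum, map_mul, map_sub, map_pow, fX, fC, fq] using key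

theorem Derivation.map_matrix_pow {R A m : Type*} [CommSemiring R] [CommRing A] [Algebra R A]
    [Fintype m] [DecidableEq m] (d : Derivation R A A) (M : Matrix m m A) (p : ℕ) :
    (M ^ p).map d = ∑ i ∈ range p, M ^ i * M.map d * M ^ (p - 1 - i) := by
  have hmul : ∀ P Q : Matrix m m A, (P * Q).map d = P * Q.map d + P.map d * Q := by
    intro P Q
    ext i j
    simp only [Matrix.map_apply, Matrix.mul_apply, Matrix.add_apply, map_sum, Derivation.leibniz,
      smul_eq_mul, sum_add_distrib]
    congr 1
    exact sum_congr rfl fun _ _ => mul_comm _ _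
  induction p with
  | zero =>
    ext i j
    by_cases hij : i = j <;> simp [hij]
  | succ p ih =>
    rw [pow_succ, hmul, ih, sum_range_succ, sum_mul, add_comm]
    congr 1
    · refine sum_congr rfl fun i hi => ?_
      have hi' := mem_range.mp hi
      rw [mul_assoc, ← pow_succ]
      congr 2
      omega
    · simp

/-- Degree-`N` homogeneous component of `(δ_ρ (𝒪^{−1})^λ_μ) φ^ρ_ν = −C^λ_{ρν} (𝒪^{−1})^ρ_μ`,
where `𝒪^{−1} = e^{−𝒞} = ∑_p ((−1)^p/p!) 𝒞^p` and `φ = ∑_p ((−1)^p B_p/p!) 𝒞^p`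
(the realization of identity (11) of Theorem 2.2). -/
theorem statement10 (k : Type*) [Field k] [CharZero k] (n : ℕ)
    (C : Fin n → Fin n → Fin n → k)
    (hanti : ∀ l μ ν, C l μ ν = - C l ν μ)
    (hjac : ∀ μ ν τ σ, ∑ ρ, (C ρ μ ν * C σ ρ τ + C ρ ν τ * C σ ρ μ + C ρ τ μ * C σ ρ ν) = 0)
    (𝒞 : Matrix (Fin n) (Fin n) (MvPolynomial (Fin n) k))
    (h𝒞 : ∀ α β, 𝒞 α β = ∑ g, MvPolynomial.C (C α β g) * X g)
    (N : ℕ) (l μ ν : Fin n) :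
    ∑ pq ∈ antidiagonal (N + 1),
        MvPolynomial.C ((((-1) ^ pq.1 / pq.1.factorial) *
            ((-1) ^ pq.2 * bernoulli pq.2 / pq.2.factorial) : ℚ) : k) *
          ∑ ρ, pderiv ρ ((𝒞 ^ pq.1) l μ) * (𝒞 ^ pq.2) ρ ν
      = - (MvPolynomial.C (((-1) ^ N / N.factorial : ℚ) : k) *
          ∑ ρ, MvPolynomial.C (C l ρ ν) * (𝒞 ^ N) ρ μ) := by
  have hT : ∀ ρ, 𝒞.map (pderiv ρ) = Matrix.of fun α β => MvPolynomial.C (C α β ρ) := by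
    intro ρ
    ext1 α β
    simp [h𝒞, Derivation.leibniz, pderiv_X, Pi.single_apply]
  have hbracket : ∀ σ, ∑ ρ, 𝒞 ρ σ • 𝒞.map (pderiv ρ)
      = 𝒞 * 𝒞.map (pderiv σ) - 𝒞.map (pderiv σ) * 𝒞 := by
    intro σ
    ext1 α β
    simp only [hT, Matrix.sum_apply, Matrix.smul_apply, Matrix.sub_apply, Matrix.mul_apply,
      Matrix.of_apply, h𝒞, smul_eq_mul, sum_mul, mul_sum]
    rw [sum_comm, sum_comm (s := univ) (t := univ) (f := fun ρ g =>
      MvPolynomial.C (C α ρ g) * X g * MvPolynomial.C (C ρ β σ)), sum_comm (s := univ) (t := univ)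
      (f := fun ρ g => MvPolynomial.C (C α ρ σ) * (MvPolynomial.C (C ρ β g) * X g)),
      ← sum_sub_distrib]
    refine sum_congr rfl fun g _ => ?_
    have hj := congrArg (fun c => MvPolynomial.C c * (X g : MvPolynomial (Fin n) k))
      (hjac σ g β α)
    simp only [map_sum, map_zero, zero_mul, sum_mul] at hj
    rw [← sum_sub_distrib, ← sub_eq_zero, ← sum_sub_distrib, ← neg_eq_zero, ← hj, ← sum_neg_distrib]
    refine sum_congr rfl fun ρ _ => ?_
    rw [hanti α β ρ, hanti ρ g β]
    simp only [map_add, map_mul, map_neg]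
    ring
  let L : Module.End ℚ (Matrix (Fin n) (Fin n) (MvPolynomial (Fin n) k)) := LinearMap.mulLeft ℚ 𝒞
  let R : Module.End ℚ (Matrix (Fin n) (Fin n) (MvPolynomial (Fin n) k)) := LinearMap.mulRight ℚ 𝒞
  have hLR : Commute L R := LinearMap.commute_mulLeft_right 𝒞 𝒞
  have hL : ∀ i M, (L ^ i) M = 𝒞 ^ i * M := fun i M => by
    rw [LinearMap.pow_mulLeft, LinearMap.mulLeft_apply]
  have hR : ∀ i M, (R ^ i) M = M * 𝒞 ^ i := fun i M => by
    rw [LinearMap.pow_mulRight, LinearMap.mulRight_apply]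
  have hS : ∀ q, ∑ ρ, (𝒞 ^ q) ρ ν • 𝒞.map (pderiv ρ) = ((L - R) ^ q) (𝒞.map (pderiv ν)) := by
    intro q
    induction q with
    | zero => simp [Matrix.one_apply, ite_smul]
    | succ q ih =>
      rw [pow_succ' (L - R), Module.End.mul_apply, ← ih, pow_succ', map_sum]
      simp only [Matrix.mul_apply, sum_smul]
      rw [sum_comm]
      refine sum_congr rfl fun σ _ => ?_
      simp only [mul_comm (𝒞 _ σ), mul_smul]
      rw [← smul_sum, hbracket]
      simp [L, R, smul_sub]
  have hterm : ∀ p q, ∑ ρ, pderiv ρ ((𝒞 ^ p) l μ) * (𝒞 ^ q) ρ ν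
      = (((∑ i ∈ range p, L ^ i * R ^ (p - 1 - i)) * (L - R) ^ q) (𝒞.map (pderiv ν))) l μ := by
    intro p q
    have h1 : ∀ ρ, pderiv ρ ((𝒞 ^ p) l μ)
        = ((∑ i ∈ range p, L ^ i * R ^ (p - 1 - i)) (𝒞.map (pderiv ρ))) l μ := by
      intro ρ
      rw [← Matrix.map_apply (f := pderiv ρ), Derivation.map_matrix_pow]
      simp only [LinearMap.sum_apply, Module.End.mul_apply, hL, hR, mul_assoc]
    rw [Module.End.mul_apply, ← hS]
    simp only [h1, LinearMap.sum_apply, Module.End.mul_apply, hL, hR, sum_mul, mul_sum,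
      Matrix.sum_apply, Matrix.smul_mul, Matrix.mul_smul, Matrix.smul_apply, smul_eq_mul]
    rw [sum_comm]
    exact sum_congr rfl fun _ _ => sum_congr rfl fun _ _ => mul_comm _ _
  have hcast : ∀ (c : ℚ) (f : MvPolynomial (Fin n) k), MvPolynomial.C (c : k) * f = c • f := by
    intro c f
    rw [Algebra.smul_def, IsScalarTower.algebraMap_apply ℚ k (MvPolynomial (Fin n) k),
      eq_ratCast (algebraMap ℚ k), MvPolynomial.algebraMap_eq]
  have hright : ∑ ρ, MvPolynomial.C (C l ρ ν) * (𝒞 ^ N) ρ μ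
      = ((R ^ N) (𝒞.map (pderiv ν))) l μ := by
    rw [hR, hT, Matrix.mul_apply]
    rfl
  have key := congrArg (fun F => (F (𝒞.map (pderiv ν))) l μ) (hLR.sum_bernoulli_mul_geom_sum N)
  simp only [← Algebra.smul_def, LinearMap.sum_apply, Matrix.sum_apply, LinearMap.smul_apply,
    Matrix.smul_apply, ← hterm, ← hright] at key
  simp only [hcast]
  have hsign : (-((-1) ^ N / N.factorial) : ℚ) = (-1) ^ (N + 1) * (1 / N.factorial) := by
    rw [pow_succ]
    ring
  rw [← neg_smul, hsign, mul_smul, ← key, smul_sum]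
  refine sum_congr rfl fun pq hpq => ?_
  rw [smul_smul, ← mem_antidiagonal.mp hpq, pow_add]
  congr 1
  rw [div_mul_div_comm]
  ring
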